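/- For any function f : [0,1] → ℝ satisfying ∫₀¹ y(1−y)|f'(y)|² dy < ∞, one has ∫₀¹ |f(y) − ∫₀¹ f(z) dz|² dy ≤ (1/2) ∫₀¹ y(1−y) |f'(y)|² dy. -/

import Mathlib

open MeasureTheory intervalIntegral

/-- A function bounded by a multiple of `y * (1 - y)` on `[0,1]` and continuous inside is
continuous up to the endpoints. -/
lemma continuousOn_Icc_of_abs_le_mul_one_sub {H : ℝ → ℝ} {C : ℝ}
    (hin : ∀ y ∈ Set.Ioo (0:ℝ) 1, ContinuousAt H y)
    (hbd : ∀ y ∈ Set.Icc (0:ℝ) 1, |H y| ≤ C * (y * (1 - y))) :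
    ContinuousOn H (Set.Icc 0 1) := by
  intro y hy
  by_cases hyo : y ∈ Set.Ioo (0:ℝ) 1
  · exact (hin y hyo).continuousWithinAt
  have hw : y * (1 - y) = 0 := by
    by_contra hne
    have h0 : y ≠ 0 := fun h => hne (by simp [h])
    have h1 : 1 - y ≠ 0 := fun h => hne (by simp [h])
    exact hyo ⟨lt_of_le_of_ne hy.1 h0.symm, lt_of_le_of_ne hy.2 fun h => h1 (by simp [h])⟩
  have hH : H y = 0 := by simpa [hw] using hbd y hy
  have hlim : Filter.Tendsto (fun z => C * (z * (1 - z))) (nhdsWithin y (Set.Icc 0 1))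
      (nhds 0) := by
    have hc : Continuous fun z : ℝ => C * (z * (1 - z)) := by fun_prop
    have := hc.continuousWithinAt (s := Set.Icc 0 1) (x := y)
    simpa [ContinuousWithinAt, hw] using this
  rw [ContinuousWithinAt, hH]
  exact squeeze_zero_norm' (Filter.eventually_of_mem self_mem_nhdsWithin hbd) hlim

/-- A primitive of a bounded function that vanishes at both endpoints of `[0,1]` is bounded by a
multiple of `y * (1 - y)`. -/
lemma abs_integral_le_mul_one_sub {u : ℝ → ℝ} {M : ℝ}
    (hu : ContinuousOn u (Set.Icc 0 1)) (hM : ∀ y ∈ Set.Icc (0:ℝ) 1, |u y| ≤ M)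
    (hzero : ∫ y in (0:ℝ)..1, u y = 0) {y : ℝ} (hy : y ∈ Set.Icc (0:ℝ) 1) :
    |∫ t in (0:ℝ)..y, u t| ≤ 2 * M * (y * (1 - y)) := by
  obtain ⟨h0, h1⟩ := hy
  have hM0 : 0 ≤ M := (abs_nonneg _).trans (hM 0 (by simp))
  have hl : |∫ t in (0:ℝ)..y, u t| ≤ M * y := by
    have := norm_integral_le_of_norm_le_const (a := 0) (b := y) (C := M) (f := u) fun t ht => by
      rw [Set.uIoc_of_le h0] at ht
      exact hM t ⟨ht.1.le, ht.2.trans h1⟩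
    simpa [abs_of_nonneg h0] using this
  have hr : |∫ t in (0:ℝ)..y, u t| ≤ M * (1 - y) := by
    have hi0 : IntervalIntegrable u volume 0 y :=
      (hu.mono (Set.Icc_subset_Icc_right h1)).intervalIntegrable_of_Icc h0
    have hi1 : IntervalIntegrable u volume y 1 :=
      (hu.mono (Set.Icc_subset_Icc_left h0)).intervalIntegrable_of_Icc h1
    have hadd := integral_add_adjacent_intervals hi0 hi1
    have := norm_integral_le_of_norm_le_const (a := y) (b := 1) (C := M) (f := u) fun t ht => by
      rw [Set.uIoc_of_le h1] at ht
      exact hM t ⟨h0.trans ht.1.le, ht.2⟩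
    rw [Real.norm_eq_abs, abs_of_nonneg (sub_nonneg.2 h1)] at this
    rw [eq_neg_of_add_eq_zero_left (hadd.trans hzero), abs_neg]
    exact this
  rcases le_total y (1 / 2) with h | h
  · nlinarith [mul_nonneg hM0 h0]
  · nlinarith [mul_nonneg hM0 (sub_nonneg.2 h1)]

/-- **Poincaré-type inequality (Lemma 2.3).** For any absolutely continuous
`f : [0,1] → ℝ` (here: continuous on `[0,1]` and differentiable in `(0,1)` with
derivative `f'`) satisfying `∫₀¹ y(1-y)|f'(y)|² dy < ∞`, one has
`∫₀¹ |f - ∫₀¹ f|² dy ≤ (1/2) ∫₀¹ y(1-y)|f'|² dy`. -/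
theorem poincare_type_inequality (f f' : ℝ → ℝ)
    (hcont : ContinuousOn f (Set.Icc 0 1))
    (hderiv : ∀ y ∈ Set.Ioo (0:ℝ) 1, HasDerivAt f (f' y) y)
    (hint : IntegrableOn (fun y => y * (1 - y) * (f' y) ^ 2) (Set.Ioo 0 1)) :
    ∫ y in (0:ℝ)..1, (f y - ∫ z in (0:ℝ)..1, f z) ^ 2
      ≤ 1 / 2 * ∫ y in (0:ℝ)..1, y * (1 - y) * (f' y) ^ 2 := by
  set m := ∫ z in (0:ℝ)..1, f z with hm
  set u : ℝ → ℝ := fun y => f y - m with hu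
  have hucont : ContinuousOn u (Set.Icc 0 1) := hcont.sub continuousOn_const
  have huderiv : ∀ y ∈ Set.Ioo (0:ℝ) 1, HasDerivAt u (f' y) y :=
    fun y hy => (hderiv y hy).sub_const m
  have hzero : ∫ y in (0:ℝ)..1, u y = 0 := by
    rw [hu, integral_sub (hcont.intervalIntegrable_of_Icc zero_le_one) (by simp)]
    simp [hm]
  obtain ⟨M, hM⟩ := isCompact_Icc.exists_bound_of_continuousOn hucont
  simp only [Real.norm_eq_abs] at hM
  set F : ℝ → ℝ := fun y => ∫ t in (0:ℝ)..y, u t with hF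
  have hFbd : ∀ y ∈ Set.Icc (0:ℝ) 1, |F y| ≤ 2 * M * (y * (1 - y)) :=
    fun y hy => abs_integral_le_mul_one_sub hucont hM hzero hy
  have hFderiv : ∀ y ∈ Set.Ioo (0:ℝ) 1, HasDerivAt F (u y) y := fun y hy =>
    integral_hasDerivAt_right
      ((hucont.mono (Set.Icc_subset_Icc_right hy.2.le)).intervalIntegrable_of_Icc hy.1.le)
      ((hucont.mono Set.Ioo_subset_Icc_self).stronglyMeasurableAtFilter isOpen_Ioo y hy)
      (huderiv y hy).continuousAt
  have hFcont : ContinuousOn F (Set.Icc 0 1) :=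
    continuousOn_Icc_of_abs_le_mul_one_sub (fun y hy => (hFderiv y hy).continuousAt) hFbd
  set H : ℝ → ℝ := fun y => F y ^ 2 * (1 - 2 * y) / (y * (1 - y)) with hH
  have hHderiv : ∀ y ∈ Set.Ioo (0:ℝ) 1, HasDerivAt H
      (((2 * F y * u y) * (1 - 2 * y) + F y ^ 2 * (-2)) / (y * (1 - y))
        - F y ^ 2 * (1 - 2 * y) ^ 2 / (y * (1 - y)) ^ 2) y := by
    intro y hy
    have hy0 : y ≠ 0 := hy.1.ne'
    have hy1 : 1 - y ≠ 0 := (sub_pos.2 hy.2).ne'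
    have hw : HasDerivAt (fun y : ℝ => y * (1 - y)) (1 - 2 * y) y :=
      ((hasDerivAt_id' y).mul ((hasDerivAt_id' y).const_sub 1)).congr_deriv (by ring)
    have hw' : HasDerivAt (fun y : ℝ => 1 - 2 * y) (-2) y :=
      (((hasDerivAt_id' y).const_mul 2).const_sub 1).congr_deriv (by ring)
    refine ((((hFderiv y hy).pow 2).mul hw').div hw (mul_ne_zero hy0 hy1)).congr_deriv ?_
    simp only [Pi.mul_apply, Pi.pow_apply]
    field_simp
    ring
  have hHbd : ∀ y ∈ Set.Icc (0:ℝ) 1, |H y| ≤ (2 * M) ^ 2 * (y * (1 - y)) := by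
    intro y hy
    have hw : 0 ≤ y * (1 - y) := mul_nonneg hy.1 (sub_nonneg.2 hy.2)
    have hw' : |1 - 2 * y| ≤ 1 := abs_le.2 ⟨by linarith [hy.2], by linarith [hy.1]⟩
    have hF2 : F y ^ 2 ≤ (2 * M * (y * (1 - y))) ^ 2 := by
      rw [← sq_abs]
      exact pow_le_pow_left₀ (abs_nonneg _) (hFbd y hy) 2
    rw [hH, abs_div, abs_mul, abs_of_nonneg hw, abs_of_nonneg (sq_nonneg (F y))]
    refine div_le_of_le_mul₀ hw (by positivity) ?_
    calc F y ^ 2 * |1 - 2 * y| ≤ F y ^ 2 * 1 := by gcongr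
      _ ≤ _ := by linarith
  have hHcont : ContinuousOn H (Set.Icc 0 1) :=
    continuousOn_Icc_of_abs_le_mul_one_sub (fun y hy => (hHderiv y hy).continuousAt) hHbd
  have hu2 : IntervalIntegrable (fun y => u y ^ 2) volume 0 1 :=
    (hucont.pow 2).intervalIntegrable_of_Icc zero_le_one
  have hf2 : IntervalIntegrable (fun y => y * (1 - y) * f' y ^ 2) volume 0 1 :=
    (intervalIntegrable_iff_integrableOn_Ioo_of_le zero_le_one).2 hint
  have key := integral_le_sub_of_hasDeriv_right_of_le (zero_le_one (α := ℝ))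
    (((hFcont.mul hucont).const_smul (2 : ℝ)).sub hHcont)
    (fun y hy => ((((hFderiv y hy).mul (huderiv y hy)).const_smul (2 : ℝ)).sub
      (hHderiv y hy)).hasDerivWithinAt)
    (φ := fun y => u y ^ 2 - 1 / 2 * (y * (1 - y) * f' y ^ 2))
    ((intervalIntegrable_iff_integrableOn_Icc_of_le zero_le_one).1
      (hu2.sub (hf2.const_mul (1 / 2))))
    (by
      intro y hy
      have hw : 0 < y * (1 - y) := mul_pos hy.1 (sub_pos.2 hy.2)
      have hy0 : y ≠ 0 := hy.1.ne'
      have hy1 : 1 - y ≠ 0 := (sub_pos.2 hy.2).ne'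
      rw [← sub_nonneg]
      have : 0 ≤ (u y - F y * (1 - 2 * y) / (y * (1 - y))) ^ 2
          + 1 / 2 * (y * (1 - y)) * (f' y + 2 * F y / (y * (1 - y))) ^ 2 := by positivity
      refine this.trans_eq ?_
      simp only [smul_eq_mul]
      field_simp
      ring)
  have hF0 : F 0 = 0 := by simp [hF]
  have hF1 : F 1 = 0 := hzero
  rw [integral_sub hu2 (hf2.const_mul (1 / 2)), intervalIntegral.integral_const_mul] at key
  simp [hH, hF0, hF1] at key
  simpa using key
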